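/- Let d ≥ 1 be an integer and 0 ≤ β < 1. For every constant C > 0 there exist M and c > 0 (depending only on d, β, C) such that: if F is a finite field with |F| ≥ M and L is a collection of lines in F^n with |L| ≥ |F|^{2(d-1)+β}, and the point set P := ⋃_{ℓ ∈ L} ℓ satisfies |P| ≤ C · |F|^{d+β}, then there exist d-planes R_1, …, R_N in F^n with N ≥ c · |F|^β such that |P ∩ ⋃_j R_j| ≥ c · |P| and, for each j, |P ∩ R_j| ≥ c · |R_j|. -/

import Mathlib

open scoped Pointwise

/-- `A` is a `k`-plane (i.e. a `k`-dimensional affine subspace) of the `F`-vector space `V`. -/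
def IsPlane (F : Type*) [Field F] {V : Type*} [AddCommGroup V] [Module F V]
    (k : ℕ) (A : Set V) : Prop :=
  ∃ (x : V) (W : Submodule F V), Module.finrank F W = k ∧ A = x +ᵥ (W : Set V)

section Planes

variable {F : Type*} [Field F] {V : Type*} [AddCommGroup V] [Module F V]

theorem IsPlane.exists_eq_vadd_of_mem {k : ℕ} {A : Set V} (hA : IsPlane F k A) {x : V}
    (hx : x ∈ A) : ∃ W : Submodule F V, Module.finrank F W = k ∧ A = x +ᵥ (W : Set V) := by
  obtain ⟨y, W, hW, rfl⟩ := hA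
  refine ⟨W, hW, ?_⟩
  rw [Set.mem_vadd_set] at hx
  obtain ⟨w, hw, rfl⟩ := hx
  ext z
  simp only [Set.mem_vadd_set_iff_neg_vadd_mem, vadd_eq_add, SetLike.mem_coe]
  have : -y + z = w + (-(y + w) + z) := by abel
  rw [this, W.add_mem_iff_right hw]

theorem IsPlane.subset_of_mem_of_mem {m : ℕ} {ℓ R : Set V} (hℓ : IsPlane F 1 ℓ)
    (hR : IsPlane F m R) {x y : V} (hxy : x ≠ y) (hx : x ∈ ℓ) (hy : y ∈ ℓ) (hx' : x ∈ R)
    (hy' : y ∈ R) : ℓ ⊆ R := by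
  obtain ⟨W, hW, rfl⟩ := hℓ.exists_eq_vadd_of_mem hx
  obtain ⟨U, hU, rfl⟩ := hR.exists_eq_vadd_of_mem hx'
  simp only [Set.mem_vadd_set_iff_neg_vadd_mem, vadd_eq_add, SetLike.mem_coe] at hy hy'
  refine Set.vadd_set_mono ?_
  intro w hw
  have hne : (⟨-x + y, hy⟩ : W) ≠ 0 := by
    intro h
    rw [Submodule.mk_eq_zero, neg_add_eq_zero] at h
    exact hxy h
  obtain ⟨c, hc⟩ := (finrank_eq_one_iff_of_nonzero' _ hne).mp hW ⟨w, hw⟩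
  have : c • (-x + y) = w := congrArg Subtype.val hc
  rw [← this]
  exact U.smul_mem c hy'

variable [Finite V]

theorem IsPlane.exists_isPlane_succ {m : ℕ} {ℓ R : Set V} (hℓ : IsPlane F 1 ℓ)
    (hR : IsPlane F m R) (hsub : ¬ ℓ ⊆ R) {x : V} (hx : x ∈ ℓ) (hx' : x ∈ R) :
    ∃ S, IsPlane F (m + 1) S ∧ R ⊆ S ∧ ℓ ⊆ S := by
  have hinter : ∀ y ∈ ℓ, y ∈ R → y = x := fun y hy hy' => by
    by_contra hne
    exact hsub (hℓ.subset_of_mem_of_mem hR hne hy hx hy' hx')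
  obtain ⟨W, hW, rfl⟩ := hℓ.exists_eq_vadd_of_mem hx
  obtain ⟨U, hU, rfl⟩ := hR.exists_eq_vadd_of_mem hx'
  refine ⟨x +ᵥ ((U ⊔ W : Submodule F V) : Set V), ⟨x, _, ?_, rfl⟩,
    Set.vadd_set_mono (SetLike.coe_subset_coe.mpr le_sup_left),
    Set.vadd_set_mono (SetLike.coe_subset_coe.mpr le_sup_right)⟩
  have hinf : U ⊓ W = ⊥ := by
    rw [eq_bot_iff]
    rintro w ⟨hwU, hwW⟩
    have := hinter (x + w) (Set.vadd_mem_vadd_set hwW) (Set.vadd_mem_vadd_set hwU)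
    simpa using this
  have := Submodule.finrank_sup_add_finrank_inf_eq U W
  rw [hinf, finrank_bot] at this
  omega

variable [Fintype F]

theorem Submodule.ncard_eq_pow_finrank (W : Submodule F V) :
    (W : Set V).ncard = Fintype.card F ^ Module.finrank F W := by
  have := Module.natCard_eq_pow_finrank (K := F) (V := W)
  rwa [Nat.card_eq_fintype_card (α := F)] at this

theorem IsPlane.ncard_eq {k : ℕ} {A : Set V} (hA : IsPlane F k A) :
    A.ncard = Fintype.card F ^ k := by
  obtain ⟨y, W, rfl, rfl⟩ := hA
  rw [← Submodule.ncard_eq_pow_finrank, Set.ncard_vadd_set]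

theorem IsPlane.ncard_inter_mul_card_le {k : ℕ} {A B : Set V} (hA : IsPlane F k A)
    (hB : IsPlane F k B) (hAB : A ≠ B) :
    (A ∩ B).ncard * Fintype.card F ≤ Fintype.card F ^ k := by
  rcases (A ∩ B).eq_empty_or_nonempty with h | ⟨x, hxA, hxB⟩
  · simp [h]
  obtain ⟨W, hW, rfl⟩ := hA.exists_eq_vadd_of_mem hxA
  obtain ⟨U, hU, rfl⟩ := hB.exists_eq_vadd_of_mem hxB
  have hne : W ≠ U := fun h => hAB (by rw [h])
  have hlt : W ⊓ U < W := by
    refine lt_of_le_of_ne inf_le_left fun h => hne ?_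
    exact Submodule.eq_of_le_of_finrank_eq (inf_eq_left.mp h) (hW.trans hU.symm)
  have hlt' := Submodule.finrank_lt_finrank_of_lt hlt
  rw [← Set.vadd_set_inter, Set.ncard_vadd_set, ← Submodule.coe_inf,
    Submodule.ncard_eq_pow_finrank, ← pow_succ]
  exact Nat.pow_le_pow_right Fintype.card_pos (by omega)

theorem IsPlane.inter_subset_of_ne {m : ℕ} {R S T : Set V} (hR : IsPlane F m R)
    (hS : IsPlane F (m + 1) S) (hT : IsPlane F (m + 1) T) (hRS : R ⊆ S) (hRT : R ⊆ T)
    (hne : S ≠ T) : S ∩ T ⊆ R := by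
  have h := hS.ncard_inter_mul_card_le hT hne
  rw [pow_succ] at h
  have h' := Nat.le_of_mul_le_mul_right h Fintype.card_pos
  rw [← hR.ncard_eq] at h'
  rw [Set.eq_of_subset_of_ncard_le (Set.subset_inter hRS hRT) h']

end Planes

section Counting

open scoped Classical

theorem Finset.exists_subsets_min_degrees {α β : Type*} (r : α → β → Prop) (s : Finset α)
    (t : Finset β) {a b : ℝ} (hb : 0 ≤ b)
    (h : a * s.card + b * t.card < ∑ x ∈ s, ((t.filter (r x)).card : ℝ)) :
    ∃ s' ⊆ s, ∃ t' ⊆ t, s'.Nonempty ∧ (∀ x ∈ s', a ≤ ((t'.filter (r x)).card : ℝ)) ∧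
      ∀ y ∈ t', b ≤ ((s'.filter (fun x => r x y)).card : ℝ) := by
  induction hn : s.card + t.card using Nat.strong_induction_on generalizing s t with
  | _ n ih =>
    subst hn
    by_cases hs : ∀ x ∈ s, a ≤ ((t.filter (r x)).card : ℝ)
    · by_cases ht : ∀ y ∈ t, b ≤ ((s.filter (fun x => r x y)).card : ℝ)
      · refine ⟨s, Finset.Subset.refl _, t, Finset.Subset.refl _, ?_, hs, ht⟩
        by_contra hne
        rw [Finset.not_nonempty_iff_eq_empty] at hne
        subst hne
        simp only [Finset.card_empty, Finset.sum_empty, Nat.cast_zero, mul_zero, zero_add] at h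
        exact absurd h (not_lt.mpr (by positivity))
      · push Not at ht
        obtain ⟨y, hy, hyb⟩ := ht
        have hc := Finset.card_erase_add_one hy
        have hc' : ((t.erase y).card : ℝ) + 1 = t.card := by exact_mod_cast hc
        obtain ⟨s', hs', t', ht', hres⟩ := ih (s.card + (t.erase y).card) (by omega) s
          (t.erase y) (by
            have key : ∑ x ∈ s, ((t.filter (r x)).card : ℝ) =
                ∑ x ∈ s, (((t.erase y).filter (r x)).card : ℝ) +
                  ((s.filter (fun x => r x y)).card : ℝ) := by
              rw [Finset.card_filter (fun x => r x y) s, Nat.cast_sum, ← Finset.sum_add_distrib]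
              refine Finset.sum_congr rfl fun x _ => ?_
              rw [← Nat.cast_add, Nat.cast_inj, Finset.filter_erase]
              split_ifs with hr
              · rw [Finset.card_erase_add_one (Finset.mem_filter.mpr ⟨hy, hr⟩)]
              · rw [Finset.erase_eq_of_notMem (by simp [hr]), add_zero]
            rw [key, ← hc'] at h
            linarith) rfl
        exact ⟨s', hs', t', ht'.trans (Finset.erase_subset _ _), hres⟩
    · push Not at hs
      obtain ⟨x, hx, hxa⟩ := hs
      have hc := Finset.card_erase_add_one hx
      have hc' : ((s.erase x).card : ℝ) + 1 = s.card := by exact_mod_cast hc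
      obtain ⟨s', hs', t', ht', hres⟩ := ih ((s.erase x).card + t.card) (by omega)
        (s.erase x) t (by
          rw [← Finset.sum_erase_add _ _ hx, ← hc'] at h
          linarith) rfl
      exact ⟨s', hs'.trans (Finset.erase_subset _ _), t', ht', hres⟩

theorem Finset.sum_card_incidences {V : Type*} (L : Finset (Set V)) (P : Finset V) :
    ∑ p ∈ P, (L.filter (p ∈ ·)).card = ∑ ℓ ∈ L, (P.filter (· ∈ ℓ)).card :=
  Finset.sum_card_bipartiteAbove_eq_sum_card_bipartiteBelow (fun (p : V) (ℓ : Set V) => p ∈ ℓ)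

theorem Finset.card_filter_mem_le_ncard {V : Type*} [Finite V] (P : Finset V) (A : Set V)
    [DecidablePred (· ∈ A)] :
    (P.filter (· ∈ A)).card ≤ A.ncard := by
  rw [← Set.ncard_coe_finset]
  exact Set.ncard_le_ncard (fun x hx => (Finset.mem_filter.mp hx).2)

variable {F : Type*} [Field F] [Fintype F] {V : Type*} [AddCommGroup V] [Module F V] [Finite V]

theorem card_lines_through_mul_card_le {m : ℕ} {R : Set V} (hR : IsPlane F m R)
    (L : Finset (Set V)) (hL : ∀ ℓ ∈ L, IsPlane F 1 ℓ) (hLR : ∀ ℓ ∈ L, ℓ ⊆ R) (p : V)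
    (hp : ∀ ℓ ∈ L, p ∈ ℓ) : L.card * Fintype.card F ≤ 2 * Fintype.card F ^ m := by
  have := Fintype.ofFinite V
  have hq : 1 < Fintype.card F := Fintype.one_lt_card
  have hdisj : (L : Set (Set V)).PairwiseDisjoint (fun ℓ => (ℓ \ {p}).toFinset) := by
    intro ℓ hℓ ℓ' hℓ' hne
    rw [Function.onFun, Finset.disjoint_left]
    intro x hx hx'
    simp only [Set.mem_toFinset, Set.mem_sdiff, Set.mem_singleton_iff] at hx hx'
    exact hne ((Set.Subset.antisymm
      ((hL ℓ hℓ).subset_of_mem_of_mem (hL ℓ' hℓ') hx.2 hx.1 (hp ℓ hℓ) hx'.1 (hp ℓ' hℓ')))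
      ((hL ℓ' hℓ').subset_of_mem_of_mem (hL ℓ hℓ) hx.2 hx'.1 (hp ℓ' hℓ') hx.1 (hp ℓ hℓ)))
  have hsub : L.biUnion (fun ℓ => (ℓ \ {p}).toFinset) ⊆ R.toFinset := by
    intro x hx
    simp only [Finset.mem_biUnion, Set.mem_toFinset] at hx ⊢
    obtain ⟨ℓ, hℓ, hx⟩ := hx
    exact hLR ℓ hℓ hx.1
  have hcard := Finset.card_le_card hsub
  rw [Finset.card_biUnion hdisj, ← Set.ncard_eq_toFinset_card', hR.ncard_eq,
    Finset.sum_congr rfl (g := fun _ => Fintype.card F - 1), Finset.sum_const,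
    smul_eq_mul] at hcard
  · calc L.card * Fintype.card F ≤ L.card * (2 * (Fintype.card F - 1)) :=
          Nat.mul_le_mul_left _ (by omega)
      _ = 2 * (L.card * (Fintype.card F - 1)) := by ring
      _ ≤ _ := Nat.mul_le_mul_left _ hcard
  · intro ℓ hℓ
    rw [← Set.ncard_eq_toFinset_card', Set.ncard_sdiff_singleton_of_mem (hp ℓ hℓ),
      (hL ℓ hℓ).ncard_eq, pow_one]

theorem card_lines_mul_card_sq_le {k : ℕ} {R : Set V} (hR : IsPlane F k R)
    (L : Finset (Set V)) (hL : ∀ ℓ ∈ L, IsPlane F 1 ℓ) (hLR : ∀ ℓ ∈ L, ℓ ⊆ R) :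
    L.card * Fintype.card F ^ 2 ≤ 2 * Fintype.card F ^ (2 * k) := by
  have := Fintype.ofFinite V
  have h := Finset.sum_card_incidences L R.toFinset
  have h1 : ∑ ℓ ∈ L, (R.toFinset.filter (· ∈ ℓ)).card = L.card * Fintype.card F := by
    rw [Finset.sum_congr rfl (g := fun _ => Fintype.card F), Finset.sum_const, smul_eq_mul]
    intro ℓ hℓ
    rw [← Set.ncard_coe_finset]
    have : ((R.toFinset.filter (· ∈ ℓ) : Finset V) : Set V) = ℓ := by
      ext x
      simpa using fun hx => hLR ℓ hℓ hx
    rw [this, (hL ℓ hℓ).ncard_eq, pow_one]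
  have h2 : (∑ p ∈ R.toFinset, (L.filter (p ∈ ·)).card) * Fintype.card F ≤
      Fintype.card F ^ k * (2 * Fintype.card F ^ k) := by
    rw [Finset.sum_mul, ← hR.ncard_eq, Set.ncard_eq_toFinset_card', ← smul_eq_mul,
      ← Finset.sum_const, ← Set.ncard_eq_toFinset_card', hR.ncard_eq]
    refine Finset.sum_le_sum fun p _ => ?_
    refine card_lines_through_mul_card_le hR _ (fun ℓ hℓ => hL ℓ (Finset.mem_filter.mp hℓ).1)
      (fun ℓ hℓ => hLR ℓ (Finset.mem_filter.mp hℓ).1) p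
      (fun ℓ hℓ => (Finset.mem_filter.mp hℓ).2)
  rw [h, h1] at h2
  calc L.card * Fintype.card F ^ 2 = L.card * Fintype.card F * Fintype.card F := by ring
    _ ≤ _ := h2
    _ = _ := by ring

theorem mul_card_le_card_filter_mem_biUnion {d : ℕ} {κ : ℝ} (P : Finset V)
    (𝓡 : Finset (Set V)) (h𝓡 : ∀ R ∈ 𝓡, IsPlane F d R)
    (hκ : ∀ R ∈ 𝓡, κ * (Fintype.card F : ℝ) ^ d ≤ ((P.filter (· ∈ R)).card : ℝ))
    (hcard : (𝓡.card : ℝ) ≤ κ * Fintype.card F / 2) :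
    κ * (Fintype.card F : ℝ) ^ d / 2 * 𝓡.card ≤
      ((P.filter (fun x => ∃ R ∈ 𝓡, x ∈ R)).card : ℝ) := by
  have hq : (0 : ℝ) < Fintype.card F := by exact_mod_cast Fintype.card_pos
  induction 𝓡 using Finset.induction_on with
  | empty => simp
  | insert R 𝓢 hR ih =>
    rw [Finset.card_insert_of_notMem hR, Nat.cast_add, Nat.cast_one] at hcard ⊢
    have ih' := ih (fun S hS => h𝓡 S (Finset.mem_insert_of_mem hS))
      (fun S hS => hκ S (Finset.mem_insert_of_mem hS)) (by linarith)
    set A := P.filter (· ∈ R) with hA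
    set B := P.filter (fun x => ∃ S ∈ 𝓢, x ∈ S) with hB
    have hunion : P.filter (fun x => ∃ S ∈ insert R 𝓢, x ∈ S) = A ∪ B := by
      ext x
      simp only [hA, hB, Finset.mem_filter, Finset.mem_union, Finset.mem_insert,
        exists_eq_or_imp]
      tauto
    have hinter : (A ∩ B).card * Fintype.card F ≤ 𝓢.card * Fintype.card F ^ d := by
      have hsub : A ∩ B ⊆ 𝓢.biUnion (fun S => P.filter (· ∈ R ∩ S)) := by
        intro x
        simp only [hA, hB, Finset.mem_filter, Finset.mem_inter, Finset.mem_biUnion,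
          Set.mem_inter_iff]
        tauto
      calc (A ∩ B).card * Fintype.card F
          ≤ (∑ S ∈ 𝓢, (P.filter (· ∈ R ∩ S)).card) * Fintype.card F :=
            Nat.mul_le_mul_right _ ((Finset.card_le_card hsub).trans Finset.card_biUnion_le)
        _ ≤ ∑ S ∈ 𝓢, Fintype.card F ^ d := by
            rw [Finset.sum_mul]
            refine Finset.sum_le_sum fun S hS => ?_
            refine (Nat.mul_le_mul_right _ (Finset.card_filter_mem_le_ncard P (R ∩ S))).trans ?_
            exact (h𝓡 R (Finset.mem_insert_self _ _)).ncard_inter_mul_card_le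
              (h𝓡 S (Finset.mem_insert_of_mem hS)) (fun h => hR (h ▸ hS))
        _ = _ := by rw [Finset.sum_const, smul_eq_mul]
    have hinter' : ((A ∩ B).card : ℝ) * Fintype.card F ≤
        𝓢.card * (Fintype.card F : ℝ) ^ d := by exact_mod_cast hinter
    have hinter'' : ((A ∩ B).card : ℝ) ≤ κ * (Fintype.card F : ℝ) ^ d / 2 := by
      refine le_of_mul_le_mul_right (hinter'.trans ?_) hq
      have : (0 : ℝ) ≤ (Fintype.card F : ℝ) ^ d := by positivity
      nlinarith
    have hsum : (((A ∪ B).card : ℝ)) + (A ∩ B).card = A.card + B.card := by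
      exact_mod_cast Finset.card_union_add_card_inter A B
    have hAκ := hκ R (Finset.mem_insert_self _ _)
    rw [hunion]
    linarith

theorem exists_subset_card_ge_and_mul_card_le {d : ℕ} {κ : ℝ} (P : Finset V)
    (𝓡 : Finset (Set V)) (h𝓡 : ∀ R ∈ 𝓡, IsPlane F d R)
    (hκ : ∀ R ∈ 𝓡, κ * (Fintype.card F : ℝ) ^ d ≤ ((P.filter (· ∈ R)).card : ℝ))
    (hq : 2 ≤ κ * Fintype.card F) :
    ∃ 𝓢 ⊆ 𝓡, min (𝓡.card : ℝ) (κ * Fintype.card F / 4) ≤ 𝓢.card ∧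
      κ * (Fintype.card F : ℝ) ^ d / 2 * 𝓢.card ≤
        ((P.filter (fun x => ∃ R ∈ 𝓢, x ∈ R)).card : ℝ) := by
  have hfl : (⌊κ * Fintype.card F / 2⌋₊ : ℝ) ≤ κ * Fintype.card F / 2 :=
    Nat.floor_le (by linarith)
  have hfl' := Nat.lt_floor_add_one (κ * Fintype.card F / 2)
  have hfl1 : (1 : ℝ) ≤ ⌊κ * Fintype.card F / 2⌋₊ := by
    exact_mod_cast Nat.le_floor (by push_cast; linarith)
  obtain ⟨𝓢, hsub, hcard⟩ := Finset.exists_subset_card_eq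
    (min_le_left 𝓡.card ⌊κ * Fintype.card F / 2⌋₊)
  refine ⟨𝓢, hsub, ?_, ?_⟩
  · rw [hcard, Nat.cast_min]
    exact min_le_min le_rfl (by linarith)
  · refine mul_card_le_card_filter_mem_biUnion P 𝓢 (fun R hR => h𝓡 R (hsub hR))
      (fun R hR => hκ R (hsub hR)) ?_
    rw [hcard, Nat.cast_min]
    exact (min_le_right _ _).trans hfl

/-- The union bound with constant `c` for lines meeting a point set in at least `lam * |F|`
points. -/
def UnionBoundWith (F : Type*) [Field F] [Fintype F] (V : Type*) [AddCommGroup V] [Module F V]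
    (m : ℕ) (lam c : ℝ) : Prop :=
  ∀ (L : Finset (Set V)) (P : Finset V), (∀ ℓ ∈ L, IsPlane F 1 ℓ) →
    (∀ ℓ ∈ L, lam * Fintype.card F ≤ ((P.filter (· ∈ ℓ)).card : ℝ)) →
    c * min (L.card * (Fintype.card F : ℝ) ^ 2 / (Fintype.card F : ℝ) ^ m)
      ((Fintype.card F : ℝ) ^ (m + 1)) ≤ P.card

theorem exists_dense_isPlane_succ {m : ℕ} {lam b c κ : ℝ}
    (hc : 0 < c) (hbound : UnionBoundWith F V m lam c) (L : Finset (Set V)) (P : Finset V)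
    (hL : ∀ ℓ ∈ L, IsPlane F 1 ℓ) (hlam : 1 ≤ lam * Fintype.card F)
    (hdeg : ∀ ℓ ∈ L, 2 * lam * Fintype.card F ≤ ((P.filter (· ∈ ℓ)).card : ℝ))
    (hb : ∀ p ∈ P, b ≤ ((L.filter (p ∈ ·)).card : ℝ))
    (hbm : 4 * (Fintype.card F : ℝ) ^ m ≤ b * Fintype.card F)
    {R : Set V} (hR : IsPlane F m R)
    (hκ : κ * (Fintype.card F : ℝ) ^ m ≤ ((P.filter (· ∈ R)).card : ℝ))
    (hP : (P.card : ℝ) < c * κ * b / 2 * (Fintype.card F : ℝ) ^ 2) :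
    ∃ S, IsPlane F (m + 1) S ∧ R ⊆ S ∧
      c * (Fintype.card F : ℝ) ^ (m + 1) ≤ ((P.filter (· ∈ S)).card : ℝ) := by
  have hq : (0 : ℝ) < Fintype.card F := by exact_mod_cast Fintype.card_pos
  set q : ℝ := (Fintype.card F : ℝ)
  set Q := P.filter (· ∈ R) with hQ
  set E := L.filter (fun ℓ => ¬ ℓ ⊆ R ∧ ∃ p ∈ Q, p ∈ ℓ) with hE
  have hEdeg : ∀ p ∈ Q, b / 2 ≤ ((E.filter (p ∈ ·)).card : ℝ) := by
    intro p hp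
    have hin := card_lines_through_mul_card_le hR (L.filter (fun ℓ => p ∈ ℓ ∧ ℓ ⊆ R))
      (fun ℓ hℓ => hL ℓ (Finset.mem_filter.mp hℓ).1)
      (fun ℓ hℓ => (Finset.mem_filter.mp hℓ).2.2) p (fun ℓ hℓ => (Finset.mem_filter.mp hℓ).2.1)
    have hin' : ((L.filter (fun ℓ => p ∈ ℓ ∧ ℓ ⊆ R)).card : ℝ) * q ≤ 2 * q ^ m := by
      simp only [q]
      exact_mod_cast hin
    have hin'' : ((L.filter (fun ℓ => p ∈ ℓ ∧ ℓ ⊆ R)).card : ℝ) ≤ b / 2 :=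
      le_of_mul_le_mul_right (by linarith) hq
    have hsub : L.filter (p ∈ ·) ⊆ E.filter (p ∈ ·) ∪ L.filter (fun ℓ => p ∈ ℓ ∧ ℓ ⊆ R) := by
      intro ℓ hℓ
      simp only [hE, Finset.mem_union, Finset.mem_filter] at hℓ ⊢
      by_cases h : ℓ ⊆ R
      · exact Or.inr ⟨hℓ.1, hℓ.2, h⟩
      · exact Or.inl ⟨⟨hℓ.1, h, p, hp, hℓ.2⟩, hℓ.2⟩
    have hle : ((L.filter (p ∈ ·)).card : ℝ) ≤
        (E.filter (p ∈ ·)).card + (L.filter (fun ℓ => p ∈ ℓ ∧ ℓ ⊆ R)).card := by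
      exact_mod_cast (Finset.card_le_card hsub).trans (Finset.card_union_le _ _)
    have := hb p (Finset.mem_filter.mp hp).1
    linarith
  have hEcard : (Q.card : ℝ) * (b / 2) ≤ E.card := by
    have h1 : (Q.card : ℝ) * (b / 2) ≤ ∑ p ∈ Q, ((E.filter (p ∈ ·)).card : ℝ) := by
      rw [← nsmul_eq_mul]
      exact Finset.card_nsmul_le_sum _ _ _ hEdeg
    refine h1.trans ?_
    rw [← Nat.cast_sum, Nat.cast_le, Finset.sum_card_incidences, Finset.card_eq_sum_ones]
    refine Finset.sum_le_sum fun ℓ hℓ => Finset.card_le_one.mpr fun x hx y hy => ?_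
    simp only [hE, hQ, Finset.mem_filter] at hℓ hx hy
    by_contra hxy
    exact hℓ.2.1 ((hL ℓ hℓ.1).subset_of_mem_of_mem hR hxy hx.2 hy.2 hx.1.2 hy.1.2)
  have hS : ∀ ℓ ∈ E, ∃ S, IsPlane F (m + 1) S ∧ R ⊆ S ∧ ℓ ⊆ S := by
    intro ℓ hℓ
    simp only [hE, hQ, Finset.mem_filter] at hℓ
    obtain ⟨hℓL, hℓR, p, ⟨-, hpR⟩, hpℓ⟩ := hℓ
    exact (hL ℓ hℓL).exists_isPlane_succ hR hℓR hpℓ hpR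
  choose! s hs hRs hℓs using hS
  by_contra! hcon
  have hfib : ∀ S ∈ E.image s, c * ((E.filter (s · = S)).card * q ^ 2 / q ^ m) ≤
      ((P.filter (· ∈ S \ R)).card : ℝ) := by
    intro S hSm
    obtain ⟨ℓ₀, hℓ₀, rfl⟩ := Finset.mem_image.mp hSm
    have h1 := hbound (E.filter (s · = s ℓ₀)) (P.filter (· ∈ s ℓ₀ \ R))
      (fun ℓ hℓ => hL ℓ (Finset.mem_filter.mp (Finset.mem_filter.mp hℓ).1).1) (by
        intro ℓ hℓ
        obtain ⟨hℓE, hsℓ⟩ := Finset.mem_filter.mp hℓ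
        have hℓE' := hℓE
        simp only [hE, hQ, Finset.mem_filter] at hℓE'
        obtain ⟨hℓL, hℓR, p, ⟨-, hpR⟩, hpℓ⟩ := hℓE'
        have hsub : P.filter (· ∈ ℓ) ⊆
            insert p ((P.filter (· ∈ s ℓ₀ \ R)).filter (· ∈ ℓ)) := by
          intro x hx
          simp only [Finset.mem_filter, Finset.mem_insert, Set.mem_sdiff] at hx ⊢
          by_cases hxR : x ∈ R
          · left
            by_contra hne
            exact hℓR ((hL ℓ hℓL).subset_of_mem_of_mem hR hne hx.2 hpℓ hxR hpR)
          · exact Or.inr ⟨⟨hx.1, hsℓ ▸ hℓs ℓ hℓE hx.2, hxR⟩, hx.2⟩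
        have hle : ((P.filter (· ∈ ℓ)).card : ℝ) ≤
            ((P.filter (· ∈ s ℓ₀ \ R)).filter (· ∈ ℓ)).card + 1 := by
          exact_mod_cast (Finset.card_le_card hsub).trans (Finset.card_insert_le _ _)
        have := hdeg ℓ hℓL
        linarith)
    rcases min_cases ((E.filter (s · = s ℓ₀)).card * q ^ 2 / q ^ m) (q ^ (m + 1)) with h | h
    · rwa [h.1] at h1
    · rw [h.1] at h1
      refine absurd (hcon (s ℓ₀) (hs _ hℓ₀) (hRs _ hℓ₀)) (not_lt.mpr (h1.trans ?_))
      exact_mod_cast Finset.card_le_card fun x hx => by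
        simp only [Finset.mem_filter, Set.mem_sdiff] at hx ⊢
        exact ⟨hx.1, hx.2.1⟩
  have hsum : c * (E.card * q ^ 2 / q ^ m) ≤ P.card := by
    calc c * (E.card * q ^ 2 / q ^ m)
        = ∑ S ∈ E.image s, c * ((E.filter (s · = S)).card * q ^ 2 / q ^ m) := by
          rw [Finset.card_eq_sum_card_image s E, Nat.cast_sum, Finset.sum_mul,
            Finset.sum_div, Finset.mul_sum]
      _ ≤ ∑ S ∈ E.image s, ((P.filter (· ∈ S \ R)).card : ℝ) := Finset.sum_le_sum hfib
      _ = (((E.image s).biUnion (fun S => P.filter (· ∈ S \ R))).card : ℝ) := by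
          rw [Finset.card_biUnion, Nat.cast_sum]
          intro S hS T hT hne
          obtain ⟨ℓ, hℓ, rfl⟩ := Finset.mem_image.mp hS
          obtain ⟨ℓ', hℓ', rfl⟩ := Finset.mem_image.mp hT
          rw [Function.onFun, Finset.disjoint_left]
          intro x hx hx'
          simp only [Finset.mem_filter, Set.mem_sdiff] at hx hx'
          exact hx.2.2 (hR.inter_subset_of_ne (hs ℓ hℓ) (hs ℓ' hℓ') (hRs ℓ hℓ) (hRs ℓ' hℓ')
            hne ⟨hx.2.1, hx'.2.1⟩)
      _ ≤ P.card := by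
          exact_mod_cast Finset.card_le_card
            (Finset.biUnion_subset.mpr fun S _ => Finset.filter_subset _ _)
  have hb0 : 0 < b := by
    by_contra! h
    have : b * q ≤ 0 := mul_nonpos_of_nonpos_of_nonneg h hq.le
    have : 0 < q ^ m := by positivity
    linarith
  have hE' : κ * q ^ m * (b / 2) ≤ E.card :=
    (mul_le_mul_of_nonneg_right hκ (by linarith)).trans hEcard
  have : c * κ * b / 2 * q ^ 2 ≤ c * (E.card * q ^ 2 / q ^ m) := by
    have h2 : c * κ * b / 2 * q ^ 2 = c * ((κ * q ^ m * (b / 2)) * q ^ 2 / q ^ m) := by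
      field_simp
    rw [h2]
    gcongr
  linarith

/-- For every positive density `lam`, lines meeting a point set in at least `lam * |F|` points
satisfy the union bound, with a constant that depends only on `m` and `lam`. -/
def UnionBound (m : ℕ) : Prop :=
  ∀ lam : ℝ, 0 < lam → ∃ c : ℝ, 0 < c ∧ ∀ (F : Type) [Field F] [Fintype F] (V : Type)
    [AddCommGroup V] [Module F V] [Finite V], UnionBoundWith F V m lam c

theorem exists_dense_isPlane_of_min_degrees {d : ℕ}
    (hA : ∀ m, 1 ≤ m → m < d → UnionBound m) {lam δ : ℝ} (hlam : 0 < lam) (hδ : 0 < δ)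
    {m : ℕ} (hm : 1 ≤ m) :
    m ≤ d → ∃ κ > (0 : ℝ), ∃ ε > (0 : ℝ), ∃ M : ℝ,
      ∀ (F : Type) [Field F] [Fintype F] (V : Type) [AddCommGroup V] [Module F V] [Finite V]
        (L : Finset (Set V)) (P : Finset V), M ≤ Fintype.card F → (∀ ℓ ∈ L, IsPlane F 1 ℓ) →
        (∀ ℓ ∈ L, lam * Fintype.card F ≤ ((P.filter (· ∈ ℓ)).card : ℝ)) →
        (∀ p ∈ P, δ * (Fintype.card F : ℝ) ^ d / Fintype.card F ≤
          ((L.filter (p ∈ ·)).card : ℝ)) →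
        (P.card : ℝ) ≤ ε * (Fintype.card F : ℝ) ^ (d + 1) →
        ∀ ℓ ∈ L, ∃ R, IsPlane F m R ∧ ℓ ⊆ R ∧
          κ * (Fintype.card F : ℝ) ^ m ≤ ((P.filter (· ∈ R)).card : ℝ) := by
  induction m, hm using Nat.le_induction with
  | base =>
    intro _
    refine ⟨lam, hlam, 1, one_pos, 0, ?_⟩
    intro F _ _ V _ _ _ L P _ hL hdeg _ _ ℓ hℓ
    exact ⟨ℓ, hL ℓ hℓ, subset_rfl, by rw [pow_one]; exact hdeg ℓ hℓ⟩
  | succ m hm ih =>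
    intro hmd
    obtain ⟨κ, hκ, ε, hε, M, h⟩ := ih (by omega)
    obtain ⟨c, hc, hbound⟩ := hA m hm (by omega) (lam / 2) (by positivity)
    refine ⟨c, hc, min ε (c * κ * δ / 4), by positivity, max M (max (2 / lam) (4 / δ)), ?_⟩
    intro F _ _ V _ _ _ L P hM hL hdeg hb hP ℓ hℓ
    have hq : (1 : ℝ) ≤ Fintype.card F := by exact_mod_cast Fintype.card_pos
    obtain ⟨hM1, hM2⟩ := max_le_iff.mp hM
    obtain ⟨hM2, hM3⟩ := max_le_iff.mp hM2
    rw [div_le_iff₀ hlam] at hM2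
    rw [div_le_iff₀ hδ] at hM3
    have hP1 : (P.card : ℝ) ≤ ε * (Fintype.card F : ℝ) ^ (d + 1) :=
      hP.trans (by gcongr; exact min_le_left _ _)
    have hP2 : (P.card : ℝ) ≤ c * κ * δ / 4 * (Fintype.card F : ℝ) ^ (d + 1) :=
      hP.trans (by gcongr; exact min_le_right _ _)
    obtain ⟨R, hR, hℓR, hRκ⟩ := h F V L P hM1 hL hdeg hb hP1 ℓ hℓ
    obtain ⟨S, hS, hRS, hSc⟩ := exists_dense_isPlane_succ hc (hbound F V) L P hL
      (by linarith) (fun ℓ hℓ => by have := hdeg ℓ hℓ; linarith) hb (by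
        rw [div_mul_cancel₀ _ (by positivity)]
        calc 4 * (Fintype.card F : ℝ) ^ m
            ≤ (Fintype.card F * δ) * (Fintype.card F : ℝ) ^ m := by gcongr
          _ = δ * (Fintype.card F : ℝ) ^ (m + 1) := by ring
          _ ≤ δ * (Fintype.card F : ℝ) ^ d := by gcongr) hR hRκ (by
        refine hP2.trans_lt ?_
        have h1 : c * κ * (δ * (Fintype.card F : ℝ) ^ d / Fintype.card F) / 2 *
            (Fintype.card F : ℝ) ^ 2 = 2 * (c * κ * δ / 4 * (Fintype.card F : ℝ) ^ (d + 1)) := by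
          field_simp
          ring
        rw [h1]
        have : 0 < c * κ * δ / 4 * (Fintype.card F : ℝ) ^ (d + 1) := by positivity
        linarith)
    exact ⟨S, hS, hℓR.trans hRS, hSc⟩

theorem exists_line_subset_dense_isPlane {d : ℕ} (hd : 1 ≤ d)
    (hA : ∀ m, 1 ≤ m → m < d → UnionBound m) {lam D : ℝ} (hlam : 0 < lam) (hD : 0 < D) :
    ∃ κ > (0 : ℝ), ∃ ε > (0 : ℝ), ∃ M : ℝ,
      ∀ (F : Type) [Field F] [Fintype F] (V : Type) [AddCommGroup V] [Module F V] [Finite V]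
        (L : Finset (Set V)) (P : Finset V), M ≤ Fintype.card F → (∀ ℓ ∈ L, IsPlane F 1 ℓ) →
        (∀ ℓ ∈ L, lam * Fintype.card F ≤ ((P.filter (· ∈ ℓ)).card : ℝ)) →
        (P.card : ℝ) * (Fintype.card F : ℝ) ^ d ≤ D * L.card * (Fintype.card F : ℝ) ^ 2 →
        (P.card : ℝ) ≤ ε * (Fintype.card F : ℝ) ^ (d + 1) → L.Nonempty →
        ∃ ℓ ∈ L, ∃ R, IsPlane F d R ∧ ℓ ⊆ R ∧
          κ * (Fintype.card F : ℝ) ^ d ≤ ((P.filter (· ∈ R)).card : ℝ) := by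
  obtain ⟨κ, hκ, ε, hε, M, h⟩ := exists_dense_isPlane_of_min_degrees hA
    (lam := lam / 4) (δ := lam / (4 * D)) (by positivity) (by positivity) hd le_rfl
  refine ⟨κ, hκ, ε, hε, M, ?_⟩
  intro F _ _ V _ _ _ L P hM hL hdeg hPL hP hne
  have hq : (0 : ℝ) < Fintype.card F := by exact_mod_cast Fintype.card_pos
  have hN : (0 : ℝ) < L.card := by exact_mod_cast hne.card_pos
  obtain ⟨L', hL', P', hP', ⟨ℓ, hℓ⟩, hdeg', hb'⟩ := Finset.exists_subsets_min_degrees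
    (fun (ℓ : Set V) (p : V) => p ∈ ℓ) L P (a := lam / 4 * Fintype.card F)
    (b := lam / (4 * D) * (Fintype.card F : ℝ) ^ d / Fintype.card F) (by positivity) (by
      have h1 : L.card * (lam * Fintype.card F) ≤
          ∑ ℓ ∈ L, ((P.filter (· ∈ ℓ)).card : ℝ) := by
        rw [← nsmul_eq_mul]
        exact Finset.card_nsmul_le_sum _ _ _ hdeg
      have h2 : lam / (4 * D) * (Fintype.card F : ℝ) ^ d / Fintype.card F * P.card ≤
          lam / 4 * Fintype.card F * L.card := by
        calc lam / (4 * D) * (Fintype.card F : ℝ) ^ d / Fintype.card F * P.card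
            = lam / (4 * D) / Fintype.card F * (P.card * (Fintype.card F : ℝ) ^ d) := by ring
          _ ≤ lam / (4 * D) / Fintype.card F * (D * L.card * (Fintype.card F : ℝ) ^ 2) := by
              gcongr
          _ = _ := by field_simp
      have h3 : 0 < lam * Fintype.card F * L.card := by positivity
      linarith)
  obtain ⟨R, hR, hℓR, hRκ⟩ := h F V L' P' hM (fun ℓ hℓ => hL ℓ (hL' hℓ)) hdeg' hb'
    (le_trans (by exact_mod_cast Finset.card_le_card hP') hP) ℓ hℓ
  refine ⟨ℓ, hL' hℓ, R, hR, hℓR, hRκ.trans ?_⟩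
  exact_mod_cast Finset.card_le_card (Finset.filter_subset_filter _ hP')

theorem exists_family_dense_isPlane {d : ℕ} (hd : 1 ≤ d)
    (hA : ∀ m, 1 ≤ m → m < d → UnionBound m) {lam D : ℝ} (hlam : 0 < lam) (hD : 0 < D) :
    ∃ κ > (0 : ℝ), ∃ ε > (0 : ℝ), ∃ M : ℝ,
      ∀ (F : Type) [Field F] [Fintype F] (V : Type) [AddCommGroup V] [Module F V] [Finite V]
        (L : Finset (Set V)) (P : Finset V), M ≤ Fintype.card F → (∀ ℓ ∈ L, IsPlane F 1 ℓ) →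
        (∀ ℓ ∈ L, lam * Fintype.card F ≤ ((P.filter (· ∈ ℓ)).card : ℝ)) →
        (P.card : ℝ) * (Fintype.card F : ℝ) ^ d ≤ D * L.card * (Fintype.card F : ℝ) ^ 2 →
        (P.card : ℝ) ≤ ε * (Fintype.card F : ℝ) ^ (d + 1) →
        ∃ 𝓢 : Finset (Set V), (∀ R ∈ 𝓢, IsPlane F d R ∧
            κ * (Fintype.card F : ℝ) ^ d ≤ ((P.filter (· ∈ R)).card : ℝ)) ∧
          min (L.card * (Fintype.card F : ℝ) ^ 2 / (4 * (Fintype.card F : ℝ) ^ (2 * d)))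
            (κ * Fintype.card F / 4) ≤ 𝓢.card ∧
          κ * (Fintype.card F : ℝ) ^ d / 2 * 𝓢.card ≤
            ((P.filter (fun x => ∃ R ∈ 𝓢, x ∈ R)).card : ℝ) := by
  obtain ⟨κ, hκ, ε, hε, M, h⟩ := exists_line_subset_dense_isPlane hd hA hlam
    (D := 2 * D) (by positivity)
  refine ⟨κ, hκ, ε, hε, max M (2 / κ), ?_⟩
  intro F _ _ V _ _ _ L P hM hL hdeg hPL hP
  obtain ⟨hM1, hM2⟩ := max_le_iff.mp hM
  rw [div_le_iff₀ hκ] at hM2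
  have hq : (0 : ℝ) < Fintype.card F := by exact_mod_cast Fintype.card_pos
  have := Fintype.ofFinite (Set V)
  set 𝓡 : Finset (Set V) := Finset.univ.filter (fun R => IsPlane F d R ∧
    κ * (Fintype.card F : ℝ) ^ d ≤ ((P.filter (· ∈ R)).card : ℝ)) with h𝓡
  have hmem : ∀ R, R ∈ 𝓡 ↔ IsPlane F d R ∧
      κ * (Fintype.card F : ℝ) ^ d ≤ ((P.filter (· ∈ R)).card : ℝ) := by simp [h𝓡]
  obtain ⟨𝓢, hsub, hcard, hunion⟩ := exists_subset_card_ge_and_mul_card_le P 𝓡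
    (fun R hR => ((hmem R).mp hR).1) (fun R hR => ((hmem R).mp hR).2) (by linarith)
  refine ⟨𝓢, fun R hR => (hmem R).mp (hsub hR), le_trans (min_le_min_right _ ?_) hcard, hunion⟩
  have hsplit := Finset.card_filter_add_card_filter_not (s := L) (fun ℓ => ∃ R ∈ 𝓡, ℓ ⊆ R)
  have hhalf : L.card ≤ 2 * (L.filter (fun ℓ => ∃ R ∈ 𝓡, ℓ ⊆ R)).card := by
    by_contra! hlt
    set L₀ := L.filter (fun ℓ => ¬ ∃ R ∈ 𝓡, ℓ ⊆ R) with hL₀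
    have hlt' : L.card ≤ 2 * L₀.card := by omega
    have hlt'' : (L.card : ℝ) ≤ 2 * L₀.card := by exact_mod_cast hlt'
    obtain ⟨ℓ, hℓ, R, hR, hℓR, hRκ⟩ := h F V L₀ P hM1
      (fun ℓ hℓ => hL ℓ (Finset.mem_filter.mp hℓ).1)
      (fun ℓ hℓ => hdeg ℓ (Finset.mem_filter.mp hℓ).1) (hPL.trans (by
        calc D * L.card * (Fintype.card F : ℝ) ^ 2
            ≤ D * (2 * L₀.card) * (Fintype.card F : ℝ) ^ 2 := by gcongr
          _ = _ := by ring)) hP (Finset.card_pos.mp (by omega))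
    exact (Finset.mem_filter.mp hℓ).2 ⟨R, (hmem R).mpr ⟨hR, hRκ⟩, hℓR⟩
  have hcount : (L.filter (fun ℓ => ∃ R ∈ 𝓡, ℓ ⊆ R)).card * Fintype.card F ^ 2 ≤
      𝓡.card * (2 * Fintype.card F ^ (2 * d)) := by
    have hsub' : L.filter (fun ℓ => ∃ R ∈ 𝓡, ℓ ⊆ R) ⊆
        𝓡.biUnion (fun R => L.filter (· ⊆ R)) := by
      intro ℓ
      simp only [Finset.mem_filter, Finset.mem_biUnion]
      tauto
    calc _ ≤ (∑ R ∈ 𝓡, (L.filter (· ⊆ R)).card) * Fintype.card F ^ 2 :=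
          Nat.mul_le_mul_right _ ((Finset.card_le_card hsub').trans Finset.card_biUnion_le)
      _ ≤ ∑ R ∈ 𝓡, 2 * Fintype.card F ^ (2 * d) := by
          rw [Finset.sum_mul]
          exact Finset.sum_le_sum fun R hR => card_lines_mul_card_sq_le ((hmem R).mp hR).1 _
            (fun ℓ hℓ => hL ℓ (Finset.mem_filter.mp hℓ).1)
            (fun ℓ hℓ => (Finset.mem_filter.mp hℓ).2)
      _ = _ := by rw [Finset.sum_const, smul_eq_mul]
  rw [div_le_iff₀ (by positivity)]
  have hfinal : L.card * Fintype.card F ^ 2 ≤ 𝓡.card * (4 * Fintype.card F ^ (2 * d)) := by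
    calc L.card * Fintype.card F ^ 2 ≤ _ := Nat.mul_le_mul_right _ hhalf
      _ = 2 * ((L.filter (fun ℓ => ∃ R ∈ 𝓡, ℓ ⊆ R)).card * Fintype.card F ^ 2) := by ring
      _ ≤ 2 * (𝓡.card * (2 * Fintype.card F ^ (2 * d))) := Nat.mul_le_mul_left _ hcount
      _ = _ := by ring
  exact_mod_cast hfinal

theorem unionBound (d : ℕ) (hd : 1 ≤ d) : UnionBound d := by
  induction d using Nat.strong_induction_on with
  | _ d ih =>
    intro lam hlam
    obtain ⟨κ, hκ, ε, hε, M, h⟩ := exists_family_dense_isPlane hd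
      (fun m hm hmd => ih m hmd hm) hlam one_pos
    set M' := max M 1 with hM'
    have hM'1 : 1 ≤ M' := le_max_right _ _
    set c := min (min 1 ε) (min (min (κ / 8) (κ ^ 2 / 8)) (1 / M' ^ (d + 1))) with hc
    have hc1 : c ≤ 1 := (min_le_left _ _).trans (min_le_left _ _)
    have hcε : c ≤ ε := (min_le_left _ _).trans (min_le_right _ _)
    have hcκ : c ≤ κ / 8 := (min_le_right _ _).trans ((min_le_left _ _).trans (min_le_left _ _))
    have hcκ' : c ≤ κ ^ 2 / 8 :=
      (min_le_right _ _).trans ((min_le_left _ _).trans (min_le_right _ _))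
    have hcM : c ≤ 1 / M' ^ (d + 1) := (min_le_right _ _).trans (min_le_right _ _)
    have hc0 : 0 < c := by positivity
    refine ⟨c, hc0, ?_⟩
    intro F _ _ V _ _ _ L P hL hdeg
    have hq : (0 : ℝ) < Fintype.card F := by exact_mod_cast Fintype.card_pos
    by_contra! hlt
    have hlt1 : (P.card : ℝ) <
        c * (L.card * (Fintype.card F : ℝ) ^ 2 / (Fintype.card F : ℝ) ^ d) :=
      hlt.trans_le (by gcongr; exact min_le_left _ _)
    have hlt2 : (P.card : ℝ) < c * (Fintype.card F : ℝ) ^ (d + 1) :=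
      hlt.trans_le (by gcongr; exact min_le_right _ _)
    by_cases hM : M' ≤ Fintype.card F
    · obtain ⟨𝓢, -, hcard, hunion⟩ := h F V L P ((le_max_left _ _).trans hM) hL hdeg (by
        calc (P.card : ℝ) * (Fintype.card F : ℝ) ^ d
            ≤ c * (L.card * (Fintype.card F : ℝ) ^ 2 / (Fintype.card F : ℝ) ^ d) *
                (Fintype.card F : ℝ) ^ d := by gcongr
          _ = c * L.card * (Fintype.card F : ℝ) ^ 2 := by field_simp
          _ ≤ 1 * L.card * (Fintype.card F : ℝ) ^ 2 := by gcongr) (by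
        exact hlt2.le.trans (by gcongr))
      have hle : κ * (Fintype.card F : ℝ) ^ d / 2 *
          min (L.card * (Fintype.card F : ℝ) ^ 2 / (4 * (Fintype.card F : ℝ) ^ (2 * d)))
            (κ * Fintype.card F / 4) ≤ P.card := by
        refine le_trans (by gcongr) (hunion.trans ?_)
        exact_mod_cast Finset.card_le_card (Finset.filter_subset _ _)
      rcases min_choice (L.card * (Fintype.card F : ℝ) ^ 2 /
        (4 * (Fintype.card F : ℝ) ^ (2 * d))) (κ * Fintype.card F / 4) with hmin | hmin
      · rw [hmin] at hle
        have h1 : κ * (Fintype.card F : ℝ) ^ d / 2 *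
            (L.card * (Fintype.card F : ℝ) ^ 2 / (4 * (Fintype.card F : ℝ) ^ (2 * d))) =
            κ / 8 * (L.card * (Fintype.card F : ℝ) ^ 2 / (Fintype.card F : ℝ) ^ d) := by
          rw [two_mul d, pow_add]
          field_simp
          ring
        rw [h1] at hle
        refine absurd hlt1 (not_lt.mpr (le_trans ?_ hle))
        gcongr
      · rw [hmin] at hle
        have h1 : κ * (Fintype.card F : ℝ) ^ d / 2 * (κ * Fintype.card F / 4) =
            κ ^ 2 / 8 * (Fintype.card F : ℝ) ^ (d + 1) := by ring
        rw [h1] at hle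
        refine absurd hlt2 (not_lt.mpr (le_trans ?_ hle))
        gcongr
    · push Not at hM
      have hP : P.card = 0 := by
        have h1 : (P.card : ℝ) < 1 := by
          calc (P.card : ℝ) < c * (Fintype.card F : ℝ) ^ (d + 1) := hlt2
            _ ≤ 1 / M' ^ (d + 1) * M' ^ (d + 1) := by gcongr
            _ = 1 := by field_simp
        exact Nat.lt_one_iff.mp (by exact_mod_cast h1)
      rcases L.eq_empty_or_nonempty with rfl | ⟨ℓ, hℓ⟩
      · simp [hP] at hlt1
      · have h1 := hdeg ℓ hℓ
        have h2 : 0 < lam * Fintype.card F := by positivity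
        have h3 : (P.filter (· ∈ ℓ)).card ≤ 0 :=
          hP ▸ Finset.card_le_card (Finset.filter_subset _ _)
        rw [Nat.le_zero.mp h3] at h1
        simp only [Nat.cast_zero] at h1
        linarith

end Counting

/-- **Theorem 4 (quasi-extremizers).** -/
theorem quasi_extremizer_structure (d : ℕ) (hd : 1 ≤ d) (β : ℝ)
    (hβ0 : 0 ≤ β) (hβ1 : β < 1) :
    ∀ C : ℝ, 0 < C →
      ∃ (M : ℕ) (c : ℝ), 0 < c ∧
        ∀ (F : Type) [Field F] [Fintype F] (n : ℕ)
          (L : Set (Set (Fin n → F))),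
          M ≤ Fintype.card F →
          (∀ ℓ ∈ L, IsPlane F 1 ℓ) →
          (L.ncard : ℝ) ≥ (Fintype.card F : ℝ) ^ (2 * ((d : ℝ) - 1) + β) →
          ((⋃₀ L).ncard : ℝ) ≤ C * (Fintype.card F : ℝ) ^ ((d : ℝ) + β) →
          ∃ (N : ℕ) (R : Fin N → Set (Fin n → F)),
            Function.Injective R ∧
            (∀ j, IsPlane F d (R j)) ∧
            (N : ℝ) ≥ c * (Fintype.card F : ℝ) ^ β ∧
            ((⋃₀ L ∩ ⋃ j, R j).ncard : ℝ) ≥ c * ((⋃₀ L).ncard : ℝ) ∧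
            ∀ j, ((⋃₀ L ∩ R j).ncard : ℝ) ≥ c * ((R j).ncard : ℝ) := by
  intro C hC
  obtain ⟨κ, hκ, ε, hε, M₀, h⟩ := exists_family_dense_isPlane hd
    (fun m hm _ => unionBound m hm) one_pos hC
  obtain ⟨M₁, hM₁⟩ := Filter.eventually_atTop.mp
    ((tendsto_rpow_atTop (sub_pos.mpr hβ1)).eventually_ge_atTop (C / ε))
  set c₀ := min 1 κ / 4 with hc₀
  have hc₀pos : 0 < c₀ := by positivity
  refine ⟨⌈max M₀ M₁⌉₊, min c₀ (min (κ * c₀ / (2 * C)) κ), by positivity, ?_⟩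
  intro F _ _ n L hM hL hLcard hPcard
  have hq : (1 : ℝ) ≤ Fintype.card F := by exact_mod_cast Fintype.card_pos
  have hq0 : (0 : ℝ) < Fintype.card F := by linarith
  obtain ⟨hM0, hM1⟩ := max_le_iff.mp ((Nat.ceil_le).mp hM)
  have hroot := hM₁ _ hM1
  set x := (Fintype.card F : ℝ) ^ β with hx
  have hx0 : 0 < x := Real.rpow_pos_of_pos hq0 β
  have hxq : x ≤ Fintype.card F := by
    simpa using Real.rpow_le_rpow_of_exponent_le hq hβ1.le
  have hxε : C * x ≤ ε * Fintype.card F := by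
    rw [Real.rpow_sub hq0, Real.rpow_one, div_le_div_iff₀ hε hx0] at hroot
    linarith
  have hpowP : (Fintype.card F : ℝ) ^ ((d : ℝ) + β) = (Fintype.card F : ℝ) ^ d * x := by
    rw [Real.rpow_add hq0, Real.rpow_natCast]
  have hpowL : (Fintype.card F : ℝ) ^ (2 * ((d : ℝ) - 1) + β) * (Fintype.card F : ℝ) ^ 2 =
      (Fintype.card F : ℝ) ^ (2 * d) * x := by
    rw [← Real.rpow_natCast _ 2, ← Real.rpow_natCast _ (2 * d), hx, ← Real.rpow_add hq0,
      ← Real.rpow_add hq0]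
    congr 1
    push_cast
    ring
  rw [hpowP] at hPcard
  have hLN : (Fintype.card F : ℝ) ^ (2 * d) * x ≤ L.ncard * (Fintype.card F : ℝ) ^ 2 := by
    rw [← hpowL]
    gcongr
  classical
  have := Fintype.ofFinite (Set (Fin n → F))
  have hfilter : ∀ p : (Fin n → F) → Prop, ((⋃₀ L).toFinset.filter p).card =
      (⋃₀ L ∩ {y | p y}).ncard := by
    intro p
    rw [← Set.ncard_coe_finset]
    congr 1
    ext y
    simp
  obtain ⟨𝓢, h𝓢, hcard, hunion⟩ := h F (Fin n → F) L.toFinset (⋃₀ L).toFinset hM0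
    (fun ℓ hℓ => hL ℓ (Set.mem_toFinset.mp hℓ)) (by
      intro ℓ hℓ
      rw [Set.mem_toFinset] at hℓ
      have h1 : ⋃₀ L ∩ {y | y ∈ ℓ} = ℓ :=
        Set.inter_eq_right.mpr (Set.subset_sUnion_of_mem hℓ)
      have h2 := hfilter (· ∈ ℓ)
      rw [h1, (hL ℓ hℓ).ncard_eq, pow_one] at h2
      rw [one_mul, Nat.cast_le]
      convert h2.ge) (by
      rw [← Set.ncard_eq_toFinset_card', ← Set.ncard_eq_toFinset_card']
      calc ((⋃₀ L).ncard : ℝ) * (Fintype.card F : ℝ) ^ d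
          ≤ C * ((Fintype.card F : ℝ) ^ d * x) * (Fintype.card F : ℝ) ^ d := by gcongr
        _ = C * ((Fintype.card F : ℝ) ^ (2 * d) * x) := by ring
        _ ≤ C * (L.ncard * (Fintype.card F : ℝ) ^ 2) := by gcongr
        _ = _ := by ring) (by
      rw [← Set.ncard_eq_toFinset_card']
      calc ((⋃₀ L).ncard : ℝ) ≤ C * ((Fintype.card F : ℝ) ^ d * x) := hPcard
        _ = C * x * (Fintype.card F : ℝ) ^ d := by ring
        _ ≤ ε * Fintype.card F * (Fintype.card F : ℝ) ^ d := by gcongr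
        _ = _ := by ring)
  rw [← Set.ncard_eq_toFinset_card'] at hcard
  have hcard' : c₀ * x ≤ 𝓢.card := by
    refine le_trans (le_min ?_ ?_) hcard
    · rw [le_div_iff₀ (by positivity)]
      calc c₀ * x * (4 * (Fintype.card F : ℝ) ^ (2 * d))
          = min 1 κ * ((Fintype.card F : ℝ) ^ (2 * d) * x) := by rw [hc₀]; ring
        _ ≤ 1 * (L.ncard * (Fintype.card F : ℝ) ^ 2) := by
            gcongr
            exact min_le_left _ _
        _ = _ := one_mul _
    · calc c₀ * x = min 1 κ * x / 4 := by rw [hc₀]; ring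
        _ ≤ κ * Fintype.card F / 4 := by
            gcongr
            exact min_le_right _ _
  have hRange : ⋃ j, ((𝓢.equivFin.symm j : 𝓢) : Set (Fin n → F)) = {y | ∃ R ∈ 𝓢, y ∈ R} := by
    ext y
    simp only [Set.mem_iUnion, Set.mem_ofPred_eq]
    constructor
    · rintro ⟨j, hj⟩
      exact ⟨_, (𝓢.equivFin.symm j).2, hj⟩
    · rintro ⟨R, hR, hy⟩
      exact ⟨𝓢.equivFin ⟨R, hR⟩, by simpa using hy⟩
  refine ⟨𝓢.card, fun j => (𝓢.equivFin.symm j : 𝓢),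
    Subtype.val_injective.comp 𝓢.equivFin.symm.injective,
    fun j => (h𝓢 _ (𝓢.equivFin.symm j).2).1, ?_, ?_, fun j => ?_⟩
  · refine le_trans ?_ hcard'
    gcongr
    exact min_le_left _ _
  · rw [hRange, ← hfilter]
    calc min c₀ (min (κ * c₀ / (2 * C)) κ) * ((⋃₀ L).ncard : ℝ)
        ≤ κ * c₀ / (2 * C) * (C * ((Fintype.card F : ℝ) ^ d * x)) := by
          gcongr
          exact (min_le_right _ _).trans (min_le_left _ _)
      _ = κ * (Fintype.card F : ℝ) ^ d / 2 * (c₀ * x) := by field_simp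
      _ ≤ κ * (Fintype.card F : ℝ) ^ d / 2 * 𝓢.card := by gcongr
      _ ≤ _ := by convert hunion
  · obtain ⟨hR, hRκ⟩ := h𝓢 _ (𝓢.equivFin.symm j).2
    have h1 := hfilter (· ∈ ((𝓢.equivFin.symm j : 𝓢) : Set (Fin n → F)))
    rw [Set.ofPred_mem_eq] at h1
    rw [hR.ncard_eq, ← h1, Nat.cast_pow]
    refine le_trans ?_ (le_of_le_of_eq hRκ (by congr!))
    gcongr
    exact (min_le_right _ _).trans (min_le_right _ _)
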